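/- Let α ∈ (0,1] and β = √(1−α²). If f ∈ C²(ℝ; S²) is a solution of the shrinker profile equation α f″ + α|f′|² f + β (f × f′)′ − (x/2) f′ = 0 on ℝ, then f ∈ C^∞(ℝ; S²) and there exists c ≥ 0 such that |f′(x)| = c e^{αx²/4} for all x ∈ ℝ. Moreover, the set of nonconstant solutions is exactly { R ∘ f_{c,α} : c > 0, R ∈ SO(3) }, where f_{c,α} is the first component of the unique solution (f,g,h) of the Serret–Frenet system f′ = k g, g′ = −k f + τ h, h′ = −τ g with curvature k(x) = c e^{αx²/4}, torsion τ(x) = −βx/2, and initial conditions f(0) = e₁, g(0) = e₂, h(0) = e₃. -/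

import Mathlib

noncomputable section

open Real MeasureTheory Filter Topology

/-- `E3` is `ℝ³` with the Euclidean norm. -/
abbrev E3 : Type := EuclideanSpace ℝ (Fin 3)

def toE3 (v : Fin 3 → ℝ) : E3 := (WithLp.equiv 2 (Fin 3 → ℝ)).symm v

/-- The cross product in `ℝ³`. -/
def cross (a b : E3) : E3 :=
  toE3 ![a 1 * b 2 - a 2 * b 1, a 2 * b 0 - a 0 * b 2, a 0 * b 1 - a 1 * b 0]

def e1 : E3 := EuclideanSpace.single 0 1
def e2 : E3 := EuclideanSpace.single 1 1
def e3 : E3 := EuclideanSpace.single 2 1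

/-- `(f, g, h)` solves the Serret–Frenet system with curvature `k(x) = c e^{αx²/4}`,
torsion `τ(x) = -βx/2` and initial conditions `(e₁, e₂, e₃)`. -/
def IsSFShrink (α β c : ℝ) (f g h : ℝ → E3) : Prop :=
  (∀ x : ℝ, HasDerivAt f ((c * Real.exp (α * x ^ 2 / 4)) • g x) x) ∧
  (∀ x : ℝ, HasDerivAt g
    ((-(c * Real.exp (α * x ^ 2 / 4))) • f x + (-(β * x / 2)) • h x) x) ∧
  (∀ x : ℝ, HasDerivAt h ((β * x / 2) • g x) x) ∧
  f 0 = e1 ∧ g 0 = e2 ∧ h 0 = e3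

/-- A rotation of `ℝ³` preserving orientation: a linear isometry with determinant `1`. -/
def IsRotation (R : E3 ≃ₗᵢ[ℝ] E3) : Prop :=
  LinearMap.det (R.toLinearEquiv : E3 →ₗ[ℝ] E3) = 1

@[simp] lemma cross_apply_zero (a b : E3) : cross a b 0 = a 1 * b 2 - a 2 * b 1 := rfl

@[simp] lemma cross_apply_one (a b : E3) : cross a b 1 = a 2 * b 0 - a 0 * b 2 := rfl

@[simp] lemma cross_apply_two (a b : E3) : cross a b 2 = a 0 * b 1 - a 1 * b 0 := rfl

lemma E3.ext {a b : E3} (h0 : a 0 = b 0) (h1 : a 1 = b 1) (h2 : a 2 = b 2) : a = b := by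
  ext i
  fin_cases i
  exacts [h0, h1, h2]

lemma E3.inner_eq (a b : E3) : inner ℝ a b = a 0 * b 0 + a 1 * b 1 + a 2 * b 2 := by
  simp [PiLp.inner_apply, Fin.sum_univ_three, mul_comm]

lemma E3.norm_sq_eq (a : E3) : ‖a‖ ^ 2 = a 0 ^ 2 + a 1 ^ 2 + a 2 ^ 2 := by
  rw [EuclideanSpace.real_norm_sq_eq, Fin.sum_univ_three]

lemma E3.hasDerivAt_iff {f : ℝ → E3} {f' : E3} {x : ℝ} :
    HasDerivAt f f' x ↔ ∀ i, HasDerivAt (fun y => f y i) (f' i) x := by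
  rw [← hasDerivAt_pi]
  exact ⟨fun h => (EuclideanSpace.equiv (Fin 3) ℝ).hasFDerivAt.comp_hasDerivAt x h,
    fun h => (EuclideanSpace.equiv (Fin 3) ℝ).symm.hasFDerivAt.comp_hasDerivAt x h⟩

lemma cross_cross_self (a b : E3) : cross a (cross a b) = (inner ℝ a b) • a - (‖a‖ ^ 2) • b := by
  rw [E3.inner_eq, E3.norm_sq_eq]
  apply E3.ext <;> simp <;> ring

lemma cross_smul_right (r : ℝ) (a b : E3) : cross a (r • b) = r • cross a b := by
  apply E3.ext <;> simp <;> ring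

lemma cross_add_right (a b c : E3) : cross a (b + c) = cross a b + cross a c := by
  apply E3.ext <;> simp <;> ring

lemma cross_smul_left (r : ℝ) (a b : E3) : cross (r • a) b = r • cross a b := by
  apply E3.ext <;> simp <;> ring

@[simp] lemma cross_self_eq_zero (a : E3) : cross a a = 0 := by
  apply E3.ext <;> simp <;> ring

lemma inner_cross_left (a b : E3) : inner ℝ a (cross a b) = 0 := by
  simp [E3.inner_eq]; ring

lemma inner_cross_right (a b : E3) : inner ℝ b (cross a b) = 0 := by
  simp [E3.inner_eq]; ring

lemma norm_sq_cross (a b : E3) :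
    ‖cross a b‖ ^ 2 = ‖a‖ ^ 2 * ‖b‖ ^ 2 - (inner ℝ a b) ^ 2 := by
  simp only [E3.norm_sq_eq, E3.inner_eq, cross_apply_zero, cross_apply_one, cross_apply_two]
  ring

lemma HasDerivAt.cross {f g : ℝ → E3} {f' g' : E3} {x : ℝ} (hf : HasDerivAt f f' x)
    (hg : HasDerivAt g g' x) :
    HasDerivAt (fun y => cross (f y) (g y)) (cross f' (g x) + cross (f x) g') x := by
  rw [E3.hasDerivAt_iff] at hf hg ⊢
  intro i
  fin_cases i
  · refine (((hf 1).mul (hg 2)).sub ((hf 2).mul (hg 1))).congr_deriv ?_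
    simp; ring
  · refine (((hf 2).mul (hg 0)).sub ((hf 0).mul (hg 2))).congr_deriv ?_
    simp; ring
  · refine (((hf 0).mul (hg 1)).sub ((hf 1).mul (hg 0))).congr_deriv ?_
    simp; ring

lemma ContDiff.cross {n : WithTop ℕ∞} {f g : ℝ → E3} (hf : ContDiff ℝ n f)
    (hg : ContDiff ℝ n g) : ContDiff ℝ n (fun y => cross (f y) (g y)) := by
  rw [contDiff_euclidean] at hf hg ⊢
  intro i
  fin_cases i
  · exact ((hf 1).mul (hg 2)).sub ((hf 2).mul (hg 1))
  · exact ((hf 2).mul (hg 0)).sub ((hf 0).mul (hg 2))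
  · exact ((hf 0).mul (hg 1)).sub ((hf 1).mul (hg 0))

/-- The operator `α + β f ×` on the tangent plane at `f` is inverted by `α - β f ×`. -/
lemma eq_of_tangential_eq {α β N y : ℝ} {f v w : E3} (hαβ : α ^ 2 + β ^ 2 = 1)
    (hf : ‖f‖ = 1) (hw : inner ℝ f w = -N)
    (h : α • w + (α * N) • f + β • cross f w - y • v = 0) :
    w = -N • f + (α * y) • v - (β * y) • cross f v := by
  have hf2 : ‖f‖ ^ 2 = 1 := by rw [hf]; norm_num
  rw [E3.norm_sq_eq] at hf2
  rw [E3.inner_eq] at hw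
  have h0 := congrArg (fun u : E3 => u 0) h
  have h1 := congrArg (fun u : E3 => u 1) h
  have h2 := congrArg (fun u : E3 => u 2) h
  simp at h0 h1 h2
  apply E3.ext
  · simp
    linear_combination α * h0 - β * (f 1 * h2 - f 2 * h1) - (w 0 + N * f 0) * hαβ
      + β ^ 2 * (f 0 * hw - w 0 * hf2)
  · simp
    linear_combination α * h1 - β * (f 2 * h0 - f 0 * h2) - (w 1 + N * f 1) * hαβ
      + β ^ 2 * (f 1 * hw - w 1 * hf2)
  · simp
    linear_combination α * h2 - β * (f 0 * h1 - f 1 * h0) - (w 2 + N * f 2) * hαβ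
      + β ^ 2 * (f 2 * hw - w 2 * hf2)

section Profile

variable {α β : ℝ} {f : ℝ → E3}

lemma hasDerivAt_deriv_of_contDiff_two (hf : ContDiff ℝ 2 f) (x : ℝ) :
    HasDerivAt f (deriv f x) x ∧ HasDerivAt (deriv f) (deriv (deriv f) x) x :=
  ⟨((hf.differentiable (by norm_num)) x).hasDerivAt,
    (((ContDiff.deriv' (n := 1) hf).differentiable (by norm_num)) x).hasDerivAt⟩

lemma inner_deriv_eq_zero (hf : ContDiff ℝ 2 f) (hn : ∀ x, ‖f x‖ = 1) (x : ℝ) :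
    inner ℝ (f x) (deriv f x) = 0 := by
  obtain ⟨h1, -⟩ := hasDerivAt_deriv_of_contDiff_two hf x
  have hd := h1.norm_sq
  simp only [hn] at hd
  have := hd.unique (hasDerivAt_const x _)
  linarith

lemma inner_deriv_deriv_eq (hf : ContDiff ℝ 2 f) (hn : ∀ x, ‖f x‖ = 1) (x : ℝ) :
    inner ℝ (f x) (deriv (deriv f) x) = -‖deriv f x‖ ^ 2 := by
  obtain ⟨h1, h2⟩ := hasDerivAt_deriv_of_contDiff_two hf x
  have hd := h1.inner ℝ h2
  simp only [inner_deriv_eq_zero hf hn] at hd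
  have := hd.unique (hasDerivAt_const x _)
  rw [real_inner_self_eq_norm_sq] at this
  linarith

/-- The profile equation solved for the second derivative. -/
lemma deriv_deriv_eq (hαβ : α ^ 2 + β ^ 2 = 1) (hf : ContDiff ℝ 2 f) (hn : ∀ x, ‖f x‖ = 1)
    (heq : ∀ x : ℝ,
        α • deriv (deriv f) x + (α * ‖deriv f x‖ ^ 2) • f x
          + β • deriv (fun y => cross (f y) (deriv f y)) x - (x / 2) • deriv f x = 0) (x : ℝ) :
    deriv (deriv f) x = -‖deriv f x‖ ^ 2 • f x + (α * (x / 2)) • deriv f x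
      - (β * (x / 2)) • cross (f x) (deriv f x) := by
  obtain ⟨h1, h2⟩ := hasDerivAt_deriv_of_contDiff_two hf x
  have hx := heq x
  rw [(h1.cross h2).deriv, cross_self_eq_zero, zero_add] at hx
  exact eq_of_tangential_eq hαβ (hn x) (inner_deriv_deriv_eq hf hn x) hx

lemma contDiff_top_of_deriv_deriv_eq (hf : ContDiff ℝ 2 f)
    (h : ∀ x, deriv (deriv f) x = -‖deriv f x‖ ^ 2 • f x + (α * (x / 2)) • deriv f x
      - (β * (x / 2)) • cross (f x) (deriv f x)) :
    ContDiff ℝ (⊤ : ℕ∞) f := by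
  have key : ∀ n : ℕ, ContDiff ℝ ((n : WithTop ℕ∞) + 1) f ∧
      ContDiff ℝ ((n : WithTop ℕ∞) + 1) (deriv f) := by
    intro n
    induction n with
    | zero => exact ⟨by simpa using hf.of_le (by norm_num), by
        simpa using ContDiff.deriv' (n := 1) hf⟩
    | succ n ih =>
      have hd : Differentiable ℝ f := hf.differentiable (by norm_num)
      have hd2 : Differentiable ℝ (deriv f) :=
        (ContDiff.deriv' (n := 1) hf).differentiable (by norm_num)
      obtain ⟨h1, h2⟩ := ih
      push_cast
      refine ⟨contDiff_succ_iff_deriv.2 ⟨hd, by simp, h2⟩,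
        contDiff_succ_iff_deriv.2 ⟨hd2, by simp, ?_⟩⟩
      rw [funext h]
      exact (((h2.norm_sq ℝ).neg.smul h1).add
        ((contDiff_const.mul (contDiff_id.div_const _)).smul h2)).sub
        ((contDiff_const.mul (contDiff_id.div_const _)).smul (h1.cross h2))
  rw [contDiff_infty]
  exact fun n => (key n).1.of_le le_self_add

lemma hasDerivAt_exp_mul_sq (a x : ℝ) :
    HasDerivAt (fun y => Real.exp (a * y ^ 2 / 4)) (Real.exp (a * x ^ 2 / 4) * (a * (x / 2))) x := by
  refine ((((hasDerivAt_pow 2 x).const_mul a).div_const 4).exp).congr_deriv ?_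
  simp; ring

lemma norm_deriv_eq (hf : ContDiff ℝ 2 f) (hn : ∀ x, ‖f x‖ = 1)
    (h : ∀ x, deriv (deriv f) x = -‖deriv f x‖ ^ 2 • f x + (α * (x / 2)) • deriv f x
      - (β * (x / 2)) • cross (f x) (deriv f x)) (x : ℝ) :
    ‖deriv f x‖ = ‖deriv f 0‖ * Real.exp (α * x ^ 2 / 4) := by
  have hd : ∀ x, HasDerivAt (fun y => ‖deriv f y‖ ^ 2 * Real.exp (-(2 * α) * y ^ 2 / 4)) 0 x := by
    intro x
    have h2 := (hasDerivAt_deriv_of_contDiff_two hf x).2.norm_sq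
    refine (h2.mul (hasDerivAt_exp_mul_sq (-(2 * α)) x)).congr_deriv ?_
    rw [h x, inner_sub_right, inner_add_right, inner_smul_right, inner_smul_right,
      inner_smul_right, inner_cross_right, real_inner_comm, inner_deriv_eq_zero hf hn,
      real_inner_self_eq_norm_sq]
    ring
  have hc := is_const_of_deriv_eq_zero (fun x => (hd x).differentiableAt)
    (fun x => (hd x).deriv) x 0
  beta_reduce at hc
  have he : Real.exp (-(2 * α) * x ^ 2 / 4) * Real.exp (α * x ^ 2 / 4) ^ 2 = 1 := by
    rw [← Real.exp_nat_mul, ← Real.exp_add, Real.exp_eq_one_iff]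
    push_cast; ring
  rw [← sq_eq_sq₀ (norm_nonneg _) (by positivity), mul_pow]
  have h0 : Real.exp (-(2 * α) * 0 ^ 2 / 4) = 1 := by simp
  rw [h0] at hc
  linear_combination Real.exp (α * x ^ 2 / 4) ^ 2 * hc - ‖deriv f x‖ ^ 2 * he

end Profile

/-- The determinant of three vectors, as a triple product. -/
lemma basisFun_det_eq (u v w : E3) :
    (EuclideanSpace.basisFun (Fin 3) ℝ).toBasis.det ![u, v, w] = inner ℝ w (cross u v) := by
  rw [Module.Basis.det_apply, Matrix.det_fin_three, E3.inner_eq]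
  simp [Module.Basis.toMatrix_apply]
  ring

lemma eq_cross_of_inner_eq_one {u v w : E3} (hu : ‖u‖ = 1) (hv : ‖v‖ = 1) (hw : ‖w‖ = 1)
    (huv : inner ℝ u v = 0) (h : inner ℝ w (cross u v) = 1) : w = cross u v := by
  rw [← sub_eq_zero, ← norm_eq_zero, ← sq_eq_zero_iff, norm_sub_sq_real, norm_sq_cross, h, hu, hv,
    hw, huv]
  norm_num

lemma IsRotation.inner_cross {R : E3 ≃ₗᵢ[ℝ] E3} (hR : IsRotation R) (u v w : E3) :
    inner ℝ (R w) (cross (R u) (R v)) = inner ℝ w (cross u v) := by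
  rw [← basisFun_det_eq, ← basisFun_det_eq]
  have h := Module.Basis.det_comp (EuclideanSpace.basisFun (Fin 3) ℝ).toBasis
    (R.toLinearEquiv : E3 →ₗ[ℝ] E3) ![u, v, w]
  rw [hR, one_mul] at h
  rw [← h]
  congr 1
  ext i
  fin_cases i <;> rfl

/-- A positively oriented orthonormal frame is the image of `(e₁, e₂, e₃)` under a rotation. -/
lemma exists_rotation {u v : E3} (hu : ‖u‖ = 1) (hv : ‖v‖ = 1) (huv : inner ℝ u v = 0) :
    ∃ R : E3 ≃ₗᵢ[ℝ] E3, IsRotation R ∧ R e1 = u ∧ R e2 = v ∧ R e3 = cross u v := by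
  have hw : ‖cross u v‖ = 1 := by
    rw [← sq_eq_sq₀ (norm_nonneg _) zero_le_one, norm_sq_cross, hu, hv, huv]; norm_num
  have ho : Orthonormal ℝ ![u, v, cross u v] := by
    rw [orthonormal_iff_ite]
    intro i j
    fin_cases i <;> fin_cases j <;>
      simp [inner_cross_left, inner_cross_right, real_inner_comm, huv, hu, hv, hw]
  let b' := basisOfOrthonormalOfCardEqFinrank ho (by simp)
  have hb' : ⇑b' = ![u, v, cross u v] := coe_basisOfOrthonormalOfCardEqFinrank ho (by simp)
  let b : OrthonormalBasis (Fin 3) ℝ E3 := b'.toOrthonormalBasis (by rw [hb']; exact ho)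
  have hb : ⇑b = ![u, v, cross u v] := by simp [b, hb']
  let R : E3 ≃ₗᵢ[ℝ] E3 := (EuclideanSpace.basisFun (Fin 3) ℝ).equiv b (Equiv.refl _)
  have hR : ∀ i, R (EuclideanSpace.basisFun (Fin 3) ℝ i) = ![u, v, cross u v] i := fun i => by
    simp only [R, OrthonormalBasis.equiv_apply_basis, hb, Equiv.refl_apply]
  have h0 : R e1 = u := by simpa [e1] using hR 0
  have h1 : R e2 = v := by simpa [e2] using hR 1
  have h2 : R e3 = cross u v := by simpa [e3] using hR 2
  refine ⟨R, ?_, h0, h1, h2⟩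
  have h := Module.Basis.det_comp (EuclideanSpace.basisFun (Fin 3) ℝ).toBasis
    (R.toLinearEquiv : E3 →ₗ[ℝ] E3) (EuclideanSpace.basisFun (Fin 3) ℝ).toBasis
  have hc : ⇑(R.toLinearEquiv : E3 →ₗ[ℝ] E3) ∘ (EuclideanSpace.basisFun (Fin 3) ℝ).toBasis
      = ![u, v, cross u v] := by
    ext1 i
    simpa using hR i
  rw [hc, basisFun_det_eq, Module.Basis.det_self, mul_one, real_inner_self_eq_norm_sq, hw] at h
  rw [IsRotation, ← h]
  norm_num

section Frame

variable {α β c : ℝ} {F G H : ℝ → E3}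

/-- The quadratic form `F_i F_j + G_i G_j + H_i H_j` is conserved by the Serret–Frenet flow. -/
lemma IsSFShrink.column_inner (hS : IsSFShrink α β c F G H) (i j : Fin 3) (x : ℝ) :
    F x i * F x j + G x i * G x j + H x i * H x j = if i = j then 1 else 0 := by
  obtain ⟨hF, hG, hH, h1, h2, h3⟩ := hS
  have hd : ∀ x, HasDerivAt
      (fun x => F x i * F x j + G x i * G x j + H x i * H x j) 0 x := by
    intro x
    have f := E3.hasDerivAt_iff.1 (hF x)
    have g := E3.hasDerivAt_iff.1 (hG x)
    have h := E3.hasDerivAt_iff.1 (hH x)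
    refine ((((f i).mul (f j)).add ((g i).mul (g j))).add ((h i).mul (h j))).congr_deriv ?_
    simp; ring
  have hc := is_const_of_deriv_eq_zero (fun x => (hd x).differentiableAt)
    (fun x => (hd x).deriv) x 0
  beta_reduce at hc
  rw [hc, h1, h2, h3]
  fin_cases i <;> fin_cases j <;> simp [e1, e2, e3]

lemma IsSFShrink.inner_cross (hS : IsSFShrink α β c F G H) (x : ℝ) :
    inner ℝ (H x) (cross (F x) (G x)) = 1 := by
  obtain ⟨hF, hG, hH, h1, h2, h3⟩ := hS
  have hd : ∀ x, HasDerivAt (fun x => inner ℝ (H x) (cross (F x) (G x))) 0 x := by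
    intro x
    refine ((hH x).inner ℝ ((hF x).cross (hG x))).congr_deriv ?_
    simp [E3.inner_eq]; ring
  have hc := is_const_of_deriv_eq_zero (fun x => (hd x).differentiableAt)
    (fun x => (hd x).deriv) x 0
  beta_reduce at hc
  rw [hc, h1, h2, h3]
  simp [E3.inner_eq, e1, e2, e3]

lemma IsSFShrink.orthonormal (hS : IsSFShrink α β c F G H) (x : ℝ) :
    Orthonormal ℝ ![F x, G x, H x] := by
  let A : Matrix (Fin 3) (Fin 3) ℝ := Matrix.of ![⇑(F x), ⇑(G x), ⇑(H x)]
  have hA : A.transpose * A = 1 := by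
    ext i j
    rw [Matrix.mul_apply, Fin.sum_univ_three, Matrix.one_apply, ← hS.column_inner i j x]
    rfl
  rw [mul_eq_one_comm] at hA
  rw [orthonormal_iff_ite]
  intro i j
  have h := congrFun (congrFun hA i) j
  rw [Matrix.mul_apply, Fin.sum_univ_three, Matrix.one_apply] at h
  rw [← h, E3.inner_eq]
  fin_cases i <;> fin_cases j <;> rfl

lemma IsSFShrink.rotation_cross (hS : IsSFShrink α β c F G H) {R : E3 ≃ₗᵢ[ℝ] E3}
    (hR : IsRotation R) (x : ℝ) : cross (R (F x)) (R (G x)) = R (H x) := by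
  have ho := hS.orthonormal x
  refine (eq_cross_of_inner_eq_one ?_ ?_ ?_ ?_ ?_).symm
  · rw [R.norm_map]; exact ho.1 0
  · rw [R.norm_map]; exact ho.1 1
  · rw [R.norm_map]; exact ho.1 2
  · rw [R.inner_map_map]; exact ho.2 (i := 0) (j := 1) (by decide)
  · rw [hR.inner_cross, hS.inner_cross]

end Frame

lemma LinearIsometryEquiv.hasDerivAt_comp (R : E3 ≃ₗᵢ[ℝ] E3) {f : ℝ → E3} {f' : E3} {x : ℝ}
    (hf : HasDerivAt f f' x) : HasDerivAt (fun y => R (f y)) (R f') x :=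
  (R.toContinuousLinearEquiv : E3 →L[ℝ] E3).hasFDerivAt.comp_hasDerivAt x hf

/-- Rotated Serret–Frenet profiles solve the profile equation. -/
lemma IsSFShrink.profile {α β c : ℝ} {F G H : ℝ → E3} (hS : IsSFShrink α β c F G H)
    (hαβ : α ^ 2 + β ^ 2 = 1) (hc : 0 < c) {R : E3 ≃ₗᵢ[ℝ] E3} (hR : IsRotation R)
    {f : ℝ → E3} (hf : ∀ x, f x = R (F x)) :
    ContDiff ℝ 2 f ∧ (∀ x, ‖f x‖ = 1) ∧
      (∀ x : ℝ,
        α • deriv (deriv f) x + (α * ‖deriv f x‖ ^ 2) • f x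
          + β • deriv (fun y => cross (f y) (deriv f y)) x - (x / 2) • deriv f x = 0) ∧
      (∃ x y : ℝ, f x ≠ f y) := by
  obtain rfl : f = fun x => R (F x) := funext hf
  obtain ⟨hF, hG, hH, h1, h2, h3⟩ := id hS
  have hk : ∀ x, HasDerivAt (fun y => c * Real.exp (α * y ^ 2 / 4))
      (c * (Real.exp (α * x ^ 2 / 4) * (α * (x / 2)))) x := fun x =>
    (hasDerivAt_exp_mul_sq α x).const_mul c
  have hf1 : ∀ x, HasDerivAt (fun x => R (F x)) ((c * Real.exp (α * x ^ 2 / 4)) • R (G x)) x :=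
    fun x => by simpa using R.hasDerivAt_comp (hF x)
  have hG1 := fun x => R.hasDerivAt_comp (hG x)
  have hH1 := fun x => R.hasDerivAt_comp (hH x)
  have hd1 : deriv (fun x => R (F x)) = fun x => (c * Real.exp (α * x ^ 2 / 4)) • R (G x) :=
    funext fun x => (hf1 x).deriv
  have hf2 := fun x => (hk x).fun_smul (hG1 x)
  have hcF : Continuous F := continuous_iff_continuousAt.2 fun x => (hF x).continuousAt
  have hcG : Continuous G := continuous_iff_continuousAt.2 fun x => (hG x).continuousAt
  have hcH : Continuous H := continuous_iff_continuousAt.2 fun x => (hH x).continuousAt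
  have hnG : ∀ x, ‖G x‖ = 1 := fun x => (hS.orthonormal x).1 1
  refine ⟨?_, fun x => by rw [R.norm_map]; exact (hS.orthonormal x).1 0, fun x => ?_, ?_⟩
  · rw [show (2 : WithTop ℕ∞) = 1 + 1 by norm_num, contDiff_succ_iff_deriv]
    refine ⟨fun x => (hf1 x).differentiableAt, by simp, ?_⟩
    rw [hd1, contDiff_one_iff_deriv]
    refine ⟨fun x => (hf2 x).differentiableAt, ?_⟩
    rw [show deriv _ = _ from funext fun x => (hf2 x).deriv]
    fun_prop
  · have hx : (fun y => cross (R (F y)) (deriv (fun x => R (F x)) y)) =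
        fun y => (c * Real.exp (α * y ^ 2 / 4)) • R (H y) := by
      funext y
      rw [hd1, cross_smul_right, hS.rotation_cross hR]
    rw [hx, ((hk x).fun_smul (hH1 x)).deriv, hd1]
    simp only
    rw [(hf2 x).deriv, norm_smul, R.norm_map, hnG]
    simp only [map_add, map_smul, mul_one, Real.norm_eq_abs, sq_abs]
    match_scalars
    · ring
    · ring
    · linear_combination (c * Real.exp (α * x ^ 2 / 4) * x / 2) * hαβ
  · by_contra! hcon
    have h0 : HasDerivAt (fun x => R (F x)) 0 0 := by
      rw [show (fun x => R (F x)) = fun _ => R (F 0) from funext fun x => hcon x 0]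
      exact hasDerivAt_const _ _
    have := (hf1 0).unique h0
    rw [← norm_eq_zero, norm_smul, R.norm_map, hnG] at this
    simp [hc.ne'] at this

/-- Nonconstant solutions of the profile equation are rotated Serret–Frenet profiles. -/
lemma exists_isSFShrink {α β : ℝ} {f : ℝ → E3} (hf : ContDiff ℝ 2 f) (hn : ∀ x, ‖f x‖ = 1)
    (h : ∀ x, deriv (deriv f) x = -‖deriv f x‖ ^ 2 • f x + (α * (x / 2)) • deriv f x
      - (β * (x / 2)) • cross (f x) (deriv f x)) (hne : ∃ x y : ℝ, f x ≠ f y) :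
    ∃ c : ℝ, 0 < c ∧ ∃ R : E3 ≃ₗᵢ[ℝ] E3, IsRotation R ∧
      ∃ F G H : ℝ → E3, IsSFShrink α β c F G H ∧ ∀ x, f x = R (F x) := by
  have hN := norm_deriv_eq hf hn h
  set c := ‖deriv f 0‖ with hc
  have hc0 : 0 < c := by
    refine lt_of_le_of_ne (norm_nonneg _) fun h0 => ?_
    obtain ⟨x, y, hxy⟩ := hne
    refine hxy (is_const_of_deriv_eq_zero (hf.differentiable (by norm_num)) (fun z => ?_) x y)
    rw [← norm_eq_zero, hN, ← h0, zero_mul]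
  have hk0 : ∀ x, c * Real.exp (α * x ^ 2 / 4) ≠ 0 := fun x => by positivity
  have hk : ∀ x, HasDerivAt (fun y => c * Real.exp (α * y ^ 2 / 4))
      (c * (Real.exp (α * x ^ 2 / 4) * (α * (x / 2)))) x := fun x =>
    (hasDerivAt_exp_mul_sq α x).const_mul c
  set g : ℝ → E3 := fun x => (c * Real.exp (α * x ^ 2 / 4))⁻¹ • deriv f x with hg
  have hfg : ∀ x, deriv f x = (c * Real.exp (α * x ^ 2 / 4)) • g x := fun x => by
    rw [hg, smul_inv_smul₀ (hk0 x)]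
  have hgn : ∀ x, ‖g x‖ = 1 := fun x => by
    have := hN x
    rw [hfg, norm_smul, Real.norm_of_nonneg (by positivity)] at this
    exact mul_left_cancel₀ (hk0 x) (by rw [this, mul_one])
  have hfgi : ∀ x, inner ℝ (f x) (g x) = 0 := fun x => by
    simp only [hg, inner_smul_right, inner_deriv_eq_zero hf hn, mul_zero]
  have hf' : ∀ x, HasDerivAt f ((c * Real.exp (α * x ^ 2 / 4)) • g x) x := fun x =>
    hfg x ▸ (hasDerivAt_deriv_of_contDiff_two hf x).1
  have hg' : ∀ x, HasDerivAt g ((-(c * Real.exp (α * x ^ 2 / 4))) • f x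
      + (-(β * x / 2)) • cross (f x) (g x)) x := fun x => by
    refine (((hk x).fun_inv (hk0 x)).fun_smul
      (hasDerivAt_deriv_of_contDiff_two hf x).2).congr_deriv ?_
    rw [h x, hN x, hfg x, cross_smul_right]
    have := hk0 x
    have := Real.exp_ne_zero (α * x ^ 2 / 4)
    match_scalars <;> field_simp
    ring
  clear_value g
  have hh' : ∀ x, HasDerivAt (fun y => cross (f y) (g y)) ((β * x / 2) • g x) x := fun x => by
    refine ((hf' x).cross (hg' x)).congr_deriv ?_
    simp only [cross_smul_left, cross_add_right, cross_smul_right, cross_self_eq_zero,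
      cross_cross_self, hfgi, hn]
    match_scalars <;> ring
  obtain ⟨R, hR, hR1, hR2, hR3⟩ := exists_rotation (hn 0) (hgn 0) (hfgi 0)
  refine ⟨c, hc0, R, hR, fun x => R.symm (f x), fun x => R.symm (g x),
    fun x => R.symm (cross (f x) (g x)), ⟨fun x => ?_, fun x => ?_, fun x => ?_, ?_, ?_, ?_⟩,
    fun x => by simp⟩
  · simpa using R.symm.hasDerivAt_comp (hf' x)
  · simpa using R.symm.hasDerivAt_comp (hg' x)
  · simpa using R.symm.hasDerivAt_comp (hh' x)
  · simp [← hR1]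
  · simp [← hR2]
  · simp [← hR3]

/-- rigidity and classification for the shrinker profile equation: any `C²`,
`S²`-valued solution is smooth with `|f'(x)| = c e^{αx²/4}`, and the nonconstant solutions
are exactly the rotations of the Serret–Frenet profiles `f_{c,α}`, `c > 0`. -/
theorem shrinker_profile_rigidity_and_classification
    (α β : ℝ) (hα : α ∈ Set.Ioc (0 : ℝ) 1) (hβ : β = Real.sqrt (1 - α ^ 2)) :
    (∀ f : ℝ → E3, ContDiff ℝ 2 f → (∀ x, ‖f x‖ = 1) →
      (∀ x : ℝ,
        α • deriv (deriv f) x + (α * ‖deriv f x‖ ^ 2) • f x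
          + β • deriv (fun y => cross (f y) (deriv f y)) x - (x / 2) • deriv f x = 0) →
      ContDiff ℝ (⊤ : ℕ∞) f ∧
        ∃ c : ℝ, 0 ≤ c ∧ ∀ x : ℝ, ‖deriv f x‖ = c * Real.exp (α * x ^ 2 / 4)) ∧
    (∀ f : ℝ → E3,
      (ContDiff ℝ 2 f ∧ (∀ x, ‖f x‖ = 1) ∧
        (∀ x : ℝ,
          α • deriv (deriv f) x + (α * ‖deriv f x‖ ^ 2) • f x
            + β • deriv (fun y => cross (f y) (deriv f y)) x - (x / 2) • deriv f x = 0) ∧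
        (∃ x y : ℝ, f x ≠ f y))
      ↔ (∃ c : ℝ, 0 < c ∧ ∃ R : E3 ≃ₗᵢ[ℝ] E3, IsRotation R ∧
          ∃ F G H : ℝ → E3, IsSFShrink α β c F G H ∧ ∀ x, f x = R (F x))) := by
  have hαβ : α ^ 2 + β ^ 2 = 1 := by
    rw [hβ, Real.sq_sqrt (by nlinarith [hα.1, hα.2])]
    ring
  refine ⟨fun f hf hn heq => ?_, fun f => ⟨?_, ?_⟩⟩
  · have h := deriv_deriv_eq hαβ hf hn heq
    exact ⟨contDiff_top_of_deriv_deriv_eq hf h, _, norm_nonneg _, norm_deriv_eq hf hn h⟩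
  · rintro ⟨hf, hn, heq, hne⟩
    exact exists_isSFShrink hf hn (deriv_deriv_eq hαβ hf hn heq) hne
  · rintro ⟨c, hc, R, hR, F, G, H, hS, hfR⟩
    exact hS.profile hαβ hc hR hfR
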